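/- arXiv:1309.4032 — 5 statements merged into one kernel-verified Lean document; each statement's English description precedes it below -/
import Mathlib

section
/- Let H be an infinite-dimensional complex Hilbert space, let r and s be positive rational numbers with r + s > 1, and let φ : S(H) → S(H) be a surjective map satisfying σ(|A|^r B |A|^s) = σ(|φ(A)|^r φ(B) |φ(A)|^s) for every A in P₁(H) ∪ {I} and every B ∈ S(H). Then for every B ∈ S(H): B is a projection if and only if φ(B) is a projection, and B is a rank-one projection if and only if φ(B) is a rank-one projection. -/
/-- The absolute value `|A| = (A* A)^(1/2)`, via the continuous functional calculus. -/
noncomputable def absOp {H : Type*} [NormedAddCommGroup H] [InnerProductSpace ℂ H]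
    [CompleteSpace H] (A : H →L[ℂ] H) : H →L[ℂ] H :=
  cfc (fun t : ℝ => Real.sqrt t) (star A * A)

/-- The power `|A|^r`, via the continuous functional calculus. -/
noncomputable def absPow {H : Type*} [NormedAddCommGroup H] [InnerProductSpace ℂ H]
    [CompleteSpace H] (A : H →L[ℂ] H) (r : ℝ) : H →L[ℂ] H :=
  cfc (fun t : ℝ => t ^ r) (absOp A)

/-- An operator has rank one when its range is a one-dimensional subspace. -/
def IsRankOne {H : Type*} [NormedAddCommGroup H] [InnerProductSpace ℂ H]
    (A : H →L[ℂ] H) : Prop :=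
  Module.finrank ℂ (LinearMap.range (A : H →ₗ[ℂ] H)) = 1

/-- A rank-one projection: a self-adjoint idempotent of rank one. -/
def IsRankOneProjection {H : Type*} [NormedAddCommGroup H] [InnerProductSpace ℂ H]
    [CompleteSpace H] (A : H →L[ℂ] H) : Prop :=
  IsSelfAdjoint A ∧ A * A = A ∧ IsRankOne A

open scoped InnerProductSpace

set_option linter.all false
section helpers
variable {H : Type*} [NormedAddCommGroup H] [InnerProductSpace ℂ H] [CompleteSpace H]

theorem aux_spec_real {T : H →L[ℂ] H} {t : ℝ} (ht : t ∈ spectrum ℝ T) :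
    (t : ℂ) ∈ spectrum ℂ T := by
  have := (spectrum.algebraMap_mem_iff (R := ℝ) ℂ (a := T) (r := t)).2 ht
  simpa using this

theorem aux_idem {B : H →L[ℂ] H} (h : B * B = B) {z : ℂ} (hz : z ∈ spectrum ℂ B) :
    z = 0 ∨ z = 1 := by
  by_contra! hc
  apply hz
  rw [spectrum.mem_resolventSet_iff]
  have h1 : z - 1 ≠ 0 := sub_ne_zero.2 hc.2
  have hB : (algebraMap ℂ (H →L[ℂ] H)) z = z • 1 := Algebra.algebraMap_eq_smul_one z
  rw [hB]
  have e : (z • (1 : H →L[ℂ] H) - B) * (z⁻¹ • (1 + (z - 1)⁻¹ • B))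
      = (z * z⁻¹) • 1 + (z⁻¹ * (z * (z-1)⁻¹ - 1 - (z-1)⁻¹)) • B := by
    simp only [sub_mul, mul_add, smul_mul_assoc, mul_smul_comm, one_mul, mul_one, smul_add, h]
    module
  have e' : (z⁻¹ • (1 + (z - 1)⁻¹ • B)) * (z • (1 : H →L[ℂ] H) - B)
      = (z * z⁻¹) • 1 + (z⁻¹ * (z * (z-1)⁻¹ - 1 - (z-1)⁻¹)) • B := by
    simp only [mul_sub, add_mul, smul_mul_assoc, mul_smul_comm, one_mul, mul_one, smul_add, h]
    module
  have : z * (z-1)⁻¹ - 1 - (z-1)⁻¹ = 0 := by field_simp; ring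
  rw [this, mul_inv_cancel₀ hc.1] at e e'
  exact ⟨⟨_, _, e.trans (by simp), e'.trans (by simp)⟩, rfl⟩

open scoped Pointwise in
theorem aux_smul_idem {B : H →L[ℂ] H} (h : B * B = B) {c z : ℂ}
    (hz : z ∈ spectrum ℂ (c • B)) : z = 0 ∨ z = c := by
  by_cases hc : c = 0
  · subst hc
    left
    have h0 : (0 : H →L[ℂ] H) * 0 = 0 := by simp
    rw [zero_smul] at hz
    by_contra hz0
    apply hz
    rw [spectrum.mem_resolventSet_iff, sub_zero]
    exact (IsUnit.mk0 z hz0).map _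
  · have : z ∈ (Units.mk0 c hc) • spectrum ℂ B := by
      rw [← spectrum.unit_smul_eq_smul]; exact hz
    obtain ⟨w, hw, rfl⟩ := this
    rcases aux_idem h hw with rfl | rfl
    · left; simp
    · right; simp [Units.smul_def]

theorem aux_eig {M : H →L[ℂ] H} {x : H} {c : ℂ} (hx : x ≠ 0) (h : M x = c • x) :
    c ∈ spectrum ℂ M := by
  intro hu
  obtain ⟨u, hu⟩ := hu
  have h1 : (u : H →L[ℂ] H) x = 0 := by
    rw [hu]; simp [h, Algebra.algebraMap_eq_smul_one]
  apply hx
  have : ((↑u⁻¹ : H →L[ℂ] H) * (u : H →L[ℂ] H)) x = 0 := by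
    rw [mul_apply_eq_comp, h1, map_zero]
  simpa using this

theorem aux_idem_iff {B : H →L[ℂ] H} (hB : IsSelfAdjoint B) :
    B * B = B ↔ spectrum ℂ B ⊆ {0, 1} := by
  constructor
  · intro h z hz
    exact aux_idem h hz
  · intro h
    have e1 : B * B = cfc (fun t : ℝ => t * t) B := by
      rw [cfc_mul (fun t : ℝ => t) (fun t : ℝ => t) B, cfc_id' ℝ B]
    have e2 : cfc (fun t : ℝ => t * t) B = cfc (fun t : ℝ => t) B := by
      apply cfc_congr
      intro t ht
      have := h (aux_spec_real ht)
      simp only [Set.mem_insert_iff, Set.mem_singleton_iff, Complex.ofReal_eq_zero,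
        Complex.ofReal_eq_one] at this
      rcases this with rfl | rfl <;> simp
    rw [e1, e2, cfc_id' ℝ B]

theorem aux_absPow {T : H →L[ℂ] H} (hT : IsSelfAdjoint T) {r : ℝ} (hr : 0 < r) :
    absPow T r = cfc (fun t : ℝ => |t| ^ r) T := by
  have e1 : star T * T = cfc (fun t : ℝ => t * t) T := by
    rw [cfc_mul (fun t : ℝ => t) (fun t : ℝ => t) T, cfc_id' ℝ T, hT.star_eq]
  have e2 : absOp T = cfc (fun t : ℝ => |t|) T := by
    unfold absOp
    rw [e1, ← cfc_comp' (fun t : ℝ => Real.sqrt t) (fun t : ℝ => t * t) T]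
    simp only [Real.sqrt_mul_self_eq_abs]
  unfold absPow
  rw [e2, ← cfc_comp' (fun t : ℝ => t ^ r) (fun t : ℝ => |t|) T
    (Real.continuous_rpow_const hr.le).continuousOn]

theorem aux_absPow_idem {T : H →L[ℂ] H} (hT : IsSelfAdjoint T) (h : T * T = T)
    {r : ℝ} (hr : 0 < r) : absPow T r = T := by
  rw [aux_absPow hT hr]
  conv_rhs => rw [← cfc_id' ℝ T]
  apply cfc_congr
  intro t ht
  have := aux_idem h (aux_spec_real ht)
  simp only [Complex.ofReal_eq_zero, Complex.ofReal_eq_one] at this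
  rcases this with rfl | rfl
  · simp [hr.ne']
  · simp

theorem aux_one {T : H →L[ℂ] H} (hT : IsSelfAdjoint T) {r s : ℝ} (hr : 0 < r) (hs : 0 < s)
    (h : spectrum ℂ (absPow T r * T * absPow T s) ⊆ {1}) : T = 1 := by
  have hcr : Continuous (fun t : ℝ => |t| ^ r) :=
    (Real.continuous_rpow_const hr.le).comp continuous_abs
  have hcs : Continuous (fun t : ℝ => |t| ^ s) :=
    (Real.continuous_rpow_const hs.le).comp continuous_abs
  have e : absPow T r * T * absPow T s = cfc (fun t : ℝ => |t| ^ r * t * |t| ^ s) T := by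
    rw [aux_absPow hT hr, aux_absPow hT hs,
      cfc_mul (fun t : ℝ => |t| ^ r * t) (fun t : ℝ => |t| ^ s) T
        (hcr.mul continuous_id).continuousOn hcs.continuousOn,
      cfc_mul (fun t : ℝ => |t| ^ r) (fun t : ℝ => t) T hcr.continuousOn, cfc_id' ℝ T]
  have key : ∀ t ∈ spectrum ℝ T, t = 1 := by
    intro t ht
    have h1 : (|t| ^ r * t * |t| ^ s) ∈ spectrum ℝ (absPow T r * T * absPow T s) := by
      rw [e, cfc_map_spectrum (fun t : ℝ => |t| ^ r * t * |t| ^ s) T hT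
        ((hcr.mul continuous_id).mul hcs).continuousOn]
      exact ⟨t, ht, rfl⟩
    have h2 := h (aux_spec_real h1)
    rw [Set.mem_singleton_iff, Complex.ofReal_eq_one] at h2
    have ha : 0 ≤ |t| ^ r := by positivity
    have hb : 0 ≤ |t| ^ s := by positivity
    have htpos : 0 < t := by
      by_contra hneg
      have : |t| ^ r * t * |t| ^ s ≤ 0 :=
        mul_nonpos_of_nonpos_of_nonneg
          (mul_nonpos_of_nonneg_of_nonpos ha (not_lt.1 hneg)) hb
      linarith
    rw [abs_of_pos htpos] at h2
    have h3 : t ^ (r + 1 + s) = 1 := by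
      rw [Real.rpow_add htpos, Real.rpow_add htpos, Real.rpow_one, h2]
    exact (Real.rpow_left_inj htpos.le zero_le_one (by positivity : r + 1 + s ≠ 0)).1 (by rw [h3, Real.one_rpow])
  calc T = cfc (fun t : ℝ => t) T := (cfc_id' ℝ T).symm
    _ = cfc (fun _ : ℝ => (1 : ℝ)) T := cfc_congr (fun t ht => key t ht)
    _ = 1 := cfc_const_one ℝ T

/-- rank one projection onto x -/
noncomputable def auxP (x : H) : H →L[ℂ] H := (innerSL ℂ x).smulRight x

theorem auxP_apply (x y : H) : auxP x y = ⟪x, y⟫_ℂ • x := by simp [auxP]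

theorem auxP_sa (x : H) : IsSelfAdjoint (auxP x) := by
  rw [ContinuousLinearMap.isSelfAdjoint_iff_isSymmetric]
  intro y z
  simp [auxP_apply, inner_smul_left, inner_smul_right, mul_comm]

theorem auxP_self {x : H} (hx : ‖x‖ = 1) : auxP x x = x := by
  rw [auxP_apply, inner_self_eq_norm_sq_to_K, hx]; simp

theorem auxP_idem {x : H} (hx : ‖x‖ = 1) : auxP x * auxP x = auxP x := by
  ext y
  rw [mul_apply_eq_comp, auxP_apply x y, map_smul, auxP_self hx]

theorem auxP_rank {x : H} (hx : ‖x‖ = 1) : IsRankOneProjection (auxP x) := by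
  refine ⟨auxP_sa x, auxP_idem hx, ?_⟩
  have hx0 : x ≠ 0 := by rintro rfl; simp at hx
  have : LinearMap.range (auxP x : H →ₗ[ℂ] H) = Submodule.span ℂ {x} := by
    apply le_antisymm
    · rintro _ ⟨y, rfl⟩
      exact Submodule.mem_span_singleton.2 ⟨_, (auxP_apply x y).symm⟩
    · rw [Submodule.span_singleton_le_iff_mem]
      exact ⟨x, auxP_self hx⟩
  unfold IsRankOne
  rw [this, finrank_span_singleton hx0]

theorem aux_sa_inner {B : H →L[ℂ] H} (hB : IsSelfAdjoint B) (x y : H) :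
    ⟪B x, y⟫_ℂ = ⟪x, B y⟫_ℂ :=
  (ContinuousLinearMap.isSelfAdjoint_iff_isSymmetric.1 hB) x y

theorem aux_unit {B : H →L[ℂ] H} (h : B * B = B) (h0 : B ≠ 0) : ∃ x, ‖x‖ = 1 ∧ B x = x := by
  obtain ⟨z, hz⟩ : ∃ z, B z ≠ 0 := by
    by_contra! hc
    exact h0 (by ext z; simp [hc z])
  refine ⟨((‖B z‖⁻¹ : ℝ) : ℂ) • B z, ?_, ?_⟩
  · rw [norm_smul]; simp [hz]
  · rw [map_smul, ← mul_apply_eq_comp, h]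

theorem aux_two {B : H →L[ℂ] H} (hB : IsSelfAdjoint B) (h : B * B = B) (h0 : B ≠ 0)
    (hn : ¬ IsRankOneProjection B) :
    ∃ x y, ‖x‖ = 1 ∧ ‖y‖ = 1 ∧ B x = x ∧ B y = y ∧ ⟪x, y⟫_ℂ = 0 := by
  obtain ⟨x, hx, hBx⟩ := aux_unit h h0
  have e1 : B * auxP x = auxP x := by
    ext y; simp [auxP_apply, hBx]
  have e2 : auxP x * B = auxP x := by
    ext y; simp [auxP_apply, ← aux_sa_inner hB, hBx]
  have hD : (B - auxP x) * (B - auxP x) = B - auxP x := by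
    simp [sub_mul, mul_sub, e1, e2, h, auxP_idem hx]
  have hD0 : B - auxP x ≠ 0 := by
    intro hc
    rw [sub_eq_zero.1 hc] at hn
    exact hn (auxP_rank hx)
  obtain ⟨y, hy, hDy⟩ := aux_unit hD hD0
  have hBy : B y = y := by
    have : B * (B - auxP x) = B - auxP x := by simp [mul_sub, h, e1]
    conv_lhs => rw [← hDy]
    rw [← mul_apply_eq_comp, this, hDy]
  refine ⟨x, y, hx, hy, hBx, hBy, ?_⟩
  rw [← hDy]
  have : ⟪x, B y⟫_ℂ = ⟪x, y⟫_ℂ := by rw [hBy]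
  simp [auxP_apply, inner_sub_right, inner_smul_right, this, inner_self_eq_norm_sq_to_K, hx]

theorem aux_rank_eq {A : H →L[ℂ] H} (h : IsRankOneProjection A) : ∃ x, ‖x‖ = 1 ∧ A = auxP x := by
  obtain ⟨hA, hi, hr⟩ := h
  have h0 : A ≠ 0 := by
    rintro rfl
    unfold IsRankOne at hr
    have : LinearMap.range ((0 : H →L[ℂ] H) : H →ₗ[ℂ] H) = ⊥ := by
      ext; simp [eq_comm]
    rw [this] at hr
    simp at hr
  obtain ⟨x, hx, hAx⟩ := aux_unit hi h0
  have hx0 : x ≠ 0 := by rintro rfl; simp at hx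
  refine ⟨x, hx, ?_⟩
  ext y
  obtain ⟨c, hc⟩ := (finrank_eq_one_iff_of_nonzero'
    (⟨x, ⟨x, hAx⟩⟩ : LinearMap.range (A : H →ₗ[ℂ] H))
    (by simpa [Subtype.ext_iff] using hx0)).1 hr ⟨A y, ⟨y, rfl⟩⟩
  have hc' : c • x = A y := congrArg Subtype.val hc
  have : ⟪x, A y⟫_ℂ = ⟪x, y⟫_ℂ := by rw [← aux_sa_inner hA, hAx]
  rw [← hc', inner_smul_right, inner_self_eq_norm_sq_to_K, hx] at this
  rw [auxP_apply, ← hc', ← this]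
  simp

theorem aux_sandwich (x : H) (B : H →L[ℂ] H) :
    auxP x * B * auxP x = ⟪x, B x⟫_ℂ • auxP x := by
  ext y
  simp [auxP_apply, inner_smul_right, smul_smul, mul_comm]

theorem aux_eq {u v : H} (hu : ‖u‖ = 1) (hv : ‖v‖ = 1) (h : ⟪u, auxP v u⟫_ℂ = 1) :
    auxP u = auxP v := by
  rw [auxP_apply, inner_smul_right] at h
  have huu : ⟪u, u⟫_ℂ = 1 := by rw [inner_self_eq_norm_sq_to_K, hu]; simp
  have hvv : ⟪v, v⟫_ℂ = 1 := by rw [inner_self_eq_norm_sq_to_K, hv]; simp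
  have h1 : u - ⟪v, u⟫_ℂ • v = 0 := by
    rw [← inner_self_eq_zero (𝕜 := ℂ)]
    simp only [inner_sub_left, inner_sub_right, inner_smul_left, inner_smul_right, huu, hvv,
      inner_conj_symm, h]
    rw [mul_comm] at h
    simp [h]
  have h2 := sub_eq_zero.1 h1
  ext y
  rw [auxP_apply, auxP_apply]
  have h3 : ⟪u, y⟫_ℂ = ⟪u, v⟫_ℂ * ⟪v, y⟫_ℂ := by
    conv_lhs => rw [h2]
    rw [inner_smul_left, inner_conj_symm]
  calc ⟪u, y⟫_ℂ • u = ⟪u, y⟫_ℂ • (⟪v, u⟫_ℂ • v) := by rw [← h2]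
    _ = (⟪v, u⟫_ℂ * ⟪u, v⟫_ℂ) • ⟪v, y⟫_ℂ • v := by rw [h3]; module
    _ = _ := by rw [h, one_smul]

end helpers

theorem preserver_projections
    {H : Type*} [NormedAddCommGroup H] [InnerProductSpace ℂ H] [CompleteSpace H]
    (hH : ¬ FiniteDimensional ℂ H)
    (r s : ℚ) (hr : 0 < r) (hs : 0 < s) (hrs : 1 < r + s)
    (φ : selfAdjoint (H →L[ℂ] H) → selfAdjoint (H →L[ℂ] H))
    (hφ : Function.Surjective φ)
    (hspec : ∀ A : selfAdjoint (H →L[ℂ] H),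
      (IsRankOneProjection (A : H →L[ℂ] H) ∨ (A : H →L[ℂ] H) = 1) →
      ∀ B : selfAdjoint (H →L[ℂ] H),
        spectrum ℂ (absPow (A : H →L[ℂ] H) r * (B : H →L[ℂ] H) * absPow (A : H →L[ℂ] H) s) =
        spectrum ℂ (absPow (φ A : H →L[ℂ] H) r * (φ B : H →L[ℂ] H) *
          absPow (φ A : H →L[ℂ] H) s)):
    ∀ B : selfAdjoint (H →L[ℂ] H),
      ((B : H →L[ℂ] H) * (B : H →L[ℂ] H) = (B : H →L[ℂ] H) ↔
        (φ B : H →L[ℂ] H) * (φ B : H →L[ℂ] H) = (φ B : H →L[ℂ] H)) ∧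
      (IsRankOneProjection (B : H →L[ℂ] H) ↔ IsRankOneProjection (φ B : H →L[ℂ] H)) := by
  have hr' : (0 : ℝ) < r := by exact_mod_cast hr
  have hs' : (0 : ℝ) < s := by exact_mod_cast hs
  have hsa : ∀ B : selfAdjoint (H →L[ℂ] H), IsSelfAdjoint (B : H →L[ℂ] H) := fun B => B.2
  have p1 : absPow (1 : H →L[ℂ] H) r = 1 :=
    aux_absPow_idem (IsSelfAdjoint.one _) (mul_one _) hr'
  have p2 : absPow (1 : H →L[ℂ] H) s = 1 :=
    aux_absPow_idem (IsSelfAdjoint.one _) (mul_one _) hs'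
  have hone : (φ 1 : H →L[ℂ] H) = 1 := by
    apply aux_one (hsa _) hr' hs'
    rw [← hspec 1 (Or.inr rfl) 1]
    intro z hz
    simp only [selfAdjoint.val_one, p1, p2, mul_one] at hz
    have := aux_smul_idem (B := (1 : H →L[ℂ] H)) (mul_one _) (c := 1) (by simpa using hz)
    rcases this with rfl | rfl
    · exfalso
      apply hz
      rw [spectrum.mem_resolventSet_iff]
      simp
    · rfl
  have hσ : ∀ B : selfAdjoint (H →L[ℂ] H), spectrum ℂ (B : H →L[ℂ] H) = spectrum ℂ (φ B : H →L[ℂ] H) := by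
    intro B
    have := hspec 1 (Or.inr rfl) B
    simpa only [hone, selfAdjoint.val_one, p1, p2, mul_one, one_mul] using this
  have hproj : ∀ B : selfAdjoint (H →L[ℂ] H),
      ((B : H →L[ℂ] H) * (B : H →L[ℂ] H) = (B : H →L[ℂ] H) ↔
        (φ B : H →L[ℂ] H) * (φ B : H →L[ℂ] H) = (φ B : H →L[ℂ] H)) := by
    intro B
    rw [aux_idem_iff (hsa _), aux_idem_iff (hsa _), hσ]
  have hne : ∀ B : H →L[ℂ] H, 1 ∈ spectrum ℂ B → B ≠ 0 := by
    rintro B h rfl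
    apply h
    rw [spectrum.mem_resolventSet_iff]
    simp
  have hPspec : ∀ x : H, ‖x‖ = 1 → (1 : ℂ) ∈ spectrum ℂ (auxP x) := by
    intro x hx
    apply aux_eig (x := x) (by rintro rfl; simp at hx)
    rw [auxP_self hx, one_smul]
  have hspec' : ∀ A : selfAdjoint (H →L[ℂ] H), IsRankOneProjection (A : H →L[ℂ] H) →
      ∀ B : selfAdjoint (H →L[ℂ] H), spectrum ℂ ((A : H →L[ℂ] H) * B * A)
        = spectrum ℂ ((φ A : H →L[ℂ] H) * φ B * φ A) := by
    intro A hA B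
    have hi := hA.2.1
    have hi' := (hproj A).1 hi
    have := hspec A (Or.inl hA) B
    rwa [aux_absPow_idem (hsa A) hi hr', aux_absPow_idem (hsa A) hi hs',
      aux_absPow_idem (hsa _) hi' hr', aux_absPow_idem (hsa _) hi' hs'] at this
  have hfwd : ∀ A : selfAdjoint (H →L[ℂ] H), IsRankOneProjection (A : H →L[ℂ] H) →
      IsRankOneProjection (φ A : H →L[ℂ] H) := by
    intro A hA
    by_contra hn
    obtain ⟨a, ha, hAa⟩ := aux_rank_eq hA
    have h1 : (1 : ℂ) ∈ spectrum ℂ (φ A : H →L[ℂ] H) := by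
      rw [← hσ, hAa]; exact hPspec a ha
    obtain ⟨x, y, hx, hy, hQx, hQy, hxy⟩ :=
      aux_two (hsa (φ A)) ((hproj A).1 hA.2.1) (hne _ h1) hn
    have hyx : ⟪y, x⟫_ℂ = 0 := inner_eq_zero_symm.1 hxy
    have hx0 : x ≠ 0 := by rintro rfl; simp at hx
    have hy0 : y ≠ 0 := by rintro rfl; simp at hy
    obtain ⟨B, hB⟩ := hφ ⟨auxP x + (auxP y + auxP y),
      (auxP_sa x).add ((auxP_sa y).add (auxP_sa y))⟩
    have hB' : (φ B : H →L[ℂ] H) = auxP x + (auxP y + auxP y) := by rw [hB]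
    have hS := hspec' A hA B
    rw [hAa, aux_sandwich] at hS
    have m1 : (1 : ℂ) ∈ spectrum ℂ ((φ A : H →L[ℂ] H) * φ B * φ A) := by
      apply aux_eig hx0
      simp [hQx, hB', auxP_self hx, auxP_apply y x, hyx]
    have m2 : (2 : ℂ) ∈ spectrum ℂ ((φ A : H →L[ℂ] H) * φ B * φ A) := by
      apply aux_eig hy0
      simp [hQy, hB', auxP_self hy, auxP_apply x y, hxy, two_smul]
    rw [← hS] at m1 m2
    have c1 := (aux_smul_idem (auxP_idem ha) m1).resolve_left one_ne_zero
    have c2 := (aux_smul_idem (auxP_idem ha) m2).resolve_left two_ne_zero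
    rw [← c1] at c2
    norm_num at c2
  intro B
  refine ⟨hproj B, hfwd B, ?_⟩
  intro hφB
  by_contra hn
  obtain ⟨v, hv, hBv⟩ := aux_rank_eq hφB
  have h1 : (1 : ℂ) ∈ spectrum ℂ (B : H →L[ℂ] H) := by
    rw [hσ, hBv]; exact hPspec v hv
  obtain ⟨x, y, hx, hy, hBx, hBy, hxy⟩ :=
    aux_two (hsa B) ((hproj B).2 hφB.2.1) (hne _ h1) hn
  have key : ∀ w : H, ‖w‖ = 1 → (B : H →L[ℂ] H) w = w →
      (φ ⟨auxP w, auxP_sa w⟩ : H →L[ℂ] H) = auxP v := by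
    intro w hw hBw
    obtain ⟨u, hu, hAu⟩ := aux_rank_eq (hfwd ⟨auxP w, auxP_sa w⟩ (auxP_rank hw))
    have hS := hspec' ⟨auxP w, auxP_sa w⟩ (auxP_rank hw) B
    rw [hAu, hBv, aux_sandwich u] at hS
    have m1 : (1 : ℂ) ∈ spectrum ℂ (auxP w * (B : H →L[ℂ] H) * auxP w) := by
      apply aux_eig (x := w) (by rintro rfl; simp at hw)
      simp [auxP_self hw, hBw]
    have m2 : (1 : ℂ) ∈ spectrum ℂ (⟪u, auxP v u⟫_ℂ • auxP u) := hS ▸ m1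
    have c1 := (aux_smul_idem (auxP_idem hu) m2).resolve_left one_ne_zero
    rw [hAu]
    exact aux_eq hu hv c1.symm
  have hS := hspec' ⟨auxP x, auxP_sa x⟩ (auxP_rank hx) ⟨auxP y, auxP_sa y⟩
  rw [key x hx hBx, key y hy hBy, auxP_idem hv, auxP_idem hv] at hS
  have m1 := hPspec v hv
  rw [← hS] at m1
  apply hne _ m1
  have hyx : ⟪y, x⟫_ℂ = 0 := inner_eq_zero_symm.1 hxy
  have := aux_sandwich x (auxP y)
  rw [auxP_apply y x, hyx] at this
  simpa using this
end

section
/- Let H be an infinite-dimensional complex Hilbert space, let r and s be positive rational numbers with r + s > 1, and let φ : S(H) → S(H) be a surjective map satisfying σ(|A|^r B |A|^s) = σ(|φ(A)|^r φ(B) |φ(A)|^s) for every A in P₁(H) ∪ {I} and every B ∈ S(H). Then tr(P B P) = tr(φ(P) φ(B) φ(P)) for every rank-one projection P and every B ∈ S(H). -/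
open scoped InnerProductSpace

section helpers

variable {H : Type*} [NormedAddCommGroup H] [InnerProductSpace ℂ H] [CompleteSpace H]

lemma pt_spec_quad [Nontrivial H] (M : H →L[ℂ] H) (c : ℂ) (hM : M * M = c • M) {z : ℂ}
    (hz : z ∈ spectrum ℂ M) : z = 0 ∨ z = c := by
  have h := spectrum.subset_polynomial_aeval M (Polynomial.X ^ 2 - Polynomial.C c * Polynomial.X)
    ⟨z, hz, rfl⟩
  have h0 : Polynomial.aeval M (Polynomial.X ^ 2 - Polynomial.C c * Polynomial.X) = 0 := by
    simp [pow_two, hM, Algebra.algebraMap_eq_smul_one]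
  rw [h0, spectrum.zero_eq] at h
  simp at h
  have h2 : z * (z - c) = 0 := by linear_combination h
  rcases mul_eq_zero.1 h2 with h3 | h3
  · exact Or.inl h3
  · exact Or.inr (sub_eq_zero.1 h3)

lemma pt_eig (M : H →L[ℂ] H) (c : ℂ) (x : H) (hx : x ≠ 0) (h : M x = c • x) :
    c ∈ spectrum ℂ M := by
  rw [spectrum.mem_iff]
  rintro ⟨U, hU⟩
  have h1 : (U : H →L[ℂ] H) x = 0 := by
    rw [hU]; simp [h, Algebra.algebraMap_eq_smul_one]
  have h2 : ((↑U⁻¹ : H →L[ℂ] H) * (U : H →L[ℂ] H)) x = x := by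
    rw [Units.inv_mul]; rfl
  rw [mul_apply_eq_comp, h1, map_zero] at h2
  exact hx h2.symm

lemma pt_real {M : H →L[ℂ] H} {t : ℝ} (h : t ∈ spectrum ℝ M) : (t : ℂ) ∈ spectrum ℂ M := by
  rw [← spectrum.preimage_algebraMap (R := ℝ) ℂ] at h
  exact h

lemma pt_absPow [Nontrivial H] (Q : H →L[ℂ] H) (hQ : IsSelfAdjoint Q) (hQQ : Q * Q = Q)
    (r : ℝ) (hr : 0 < r) : absPow Q r = Q := by
  have hs : ∀ t ∈ spectrum ℝ Q, t = 0 ∨ t = 1 := by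
    intro t ht
    have := pt_spec_quad Q 1 (by simpa using hQQ) (pt_real ht)
    exact_mod_cast this
  have key : ∀ f : ℝ → ℝ, f 0 = 0 → f 1 = 1 → cfc f Q = Q := by
    intro f h0 h1
    conv_rhs => rw [← cfc_id ℝ Q]
    apply cfc_congr
    intro t ht
    rcases hs t ht with h | h <;> simp [h, h0, h1]
  have h1 : absOp Q = Q := by
    unfold absOp
    rw [hQ.star_eq, hQQ]
    exact key _ (by simp) (by simp)
  unfold absPow
  rw [h1]
  exact key _ (by simp [hr.ne']) (by simp)

lemma pt_idem (Q : H →L[ℂ] H) (hQ : IsSelfAdjoint Q)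
    (h : ∀ z ∈ spectrum ℂ Q, z = 0 ∨ z = 1) : Q * Q = Q := by
  have hs : ∀ t ∈ spectrum ℝ Q, t = 0 ∨ t = 1 := by
    intro t ht
    have := h _ (pt_real ht)
    exact_mod_cast this
  have h1 : cfc (fun t : ℝ => t * t) Q = Q * Q := by
    rw [cfc_mul (fun t : ℝ => t) (fun t : ℝ => t) Q, cfc_id' ℝ Q]
  rw [← h1]
  conv_rhs => rw [← cfc_id ℝ Q]
  apply cfc_congr
  intro t ht
  rcases hs t ht with h | h <;> simp [h]

lemma pt_absPow_cfc (T : H →L[ℂ] H) (hT : IsSelfAdjoint T) (r : ℝ) (hr : 0 < r) :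
    absPow T r = cfc (fun t : ℝ => |t| ^ r) T := by
  have h1 : absOp T = cfc (fun t : ℝ => |t|) T := by
    unfold absOp
    rw [hT.star_eq]
    have h1 : cfc (fun t : ℝ => t * t) T = T * T := by
      rw [cfc_mul (fun t : ℝ => t) (fun t : ℝ => t) T, cfc_id' ℝ T]
    rw [← h1, ← cfc_comp' (fun t : ℝ => Real.sqrt t) (fun t : ℝ => t * t) T]
    simp [Real.sqrt_mul_self_eq_abs]
  unfold absPow
  have hc : Continuous (fun t : ℝ => t ^ r) := Real.continuous_rpow_const hr.le
  rw [h1, ← cfc_comp' (fun t : ℝ => t ^ r) (fun t : ℝ => |t|) T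
    (hg := hc.continuousOn)]

lemma pt_one (T : H →L[ℂ] H) (hT : IsSelfAdjoint T) (r s : ℝ) (hr : 0 < r) (hs : 0 < s)
    (h : ∀ z ∈ spectrum ℂ (absPow T r * T * absPow T s), z = 1) : T = 1 := by
  have hcr : Continuous (fun t : ℝ => |t| ^ r) :=
    (Real.continuous_rpow_const hr.le).comp continuous_abs
  have hcs : Continuous (fun t : ℝ => |t| ^ s) :=
    (Real.continuous_rpow_const hs.le).comp continuous_abs
  have hp : absPow T r * T * absPow T s = cfc (fun t : ℝ => |t| ^ r * t * |t| ^ s) T := by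
    rw [cfc_mul (fun t : ℝ => |t| ^ r * t) (fun t : ℝ => |t| ^ s) T
      (hcr.mul continuous_id).continuousOn hcs.continuousOn,
      cfc_mul (fun t : ℝ => |t| ^ r) (fun t : ℝ => t) T hcr.continuousOn, cfc_id' ℝ T,
      pt_absPow_cfc T hT r hr, pt_absPow_cfc T hT s hs]
  rw [hp] at h
  have h1 : ∀ t ∈ spectrum ℝ T, t = 1 := by
    intro t ht
    have h2 : |t| ^ r * t * |t| ^ s ∈ spectrum ℝ (cfc (fun t : ℝ => |t| ^ r * t * |t| ^ s) T) := by
      rw [cfc_map_spectrum (fun t : ℝ => |t| ^ r * t * |t| ^ s) T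
        (hf := ((hcr.mul continuous_id).mul hcs).continuousOn)]
      exact ⟨t, ht, rfl⟩
    have h3 := h _ (pt_real h2)
    have h4 : |t| ^ r * t * |t| ^ s = 1 := by exact_mod_cast h3
    have a1 : 0 ≤ |t| ^ r := by positivity
    have a2 : 0 ≤ |t| ^ s := by positivity
    have hpos : 0 < t := by
      by_contra hn
      have : |t| ^ r * t * |t| ^ s ≤ 0 :=
        mul_nonpos_of_nonpos_of_nonneg (mul_nonpos_of_nonneg_of_nonpos a1 (not_lt.1 hn)) a2
      linarith
    rw [abs_of_pos hpos] at h4 a1 a2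
    rcases lt_trichotomy t 1 with hlt | he | hgt
    · have b1 := Real.rpow_lt_one hpos.le hlt hr
      have b2 := Real.rpow_lt_one hpos.le hlt hs
      have b3 : t ^ r * t < 1 := mul_lt_one_of_nonneg_of_lt_one_left a1 b1 hlt.le
      have := mul_lt_one_of_nonneg_of_lt_one_left (mul_nonneg a1 hpos.le) b3 b2.le
      linarith
    · exact he
    · have b1 := Real.one_lt_rpow hgt hr
      have b2 := Real.one_lt_rpow hgt hs
      have b3 := one_lt_mul_of_lt_of_le b1 hgt.le
      have := one_lt_mul_of_lt_of_le b3 b2.le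
      linarith
  rw [← cfc_id ℝ T, ← cfc_const_one ℝ T]
  apply cfc_congr
  intro t ht
  simpa using h1 t ht

lemma pt_sandwich (Q B : H →L[ℂ] H) (u : H) (hQ : ∀ x, Q x = ⟪u, x⟫_ℂ • u) :
    Q * B * Q = ⟪u, B u⟫_ℂ • Q := by
  ext x
  simp [hQ, smul_smul, inner_smul_right, mul_comm]

lemma pt_trace {ι : Type*} (e : HilbertBasis ι ℂ H) (Q B : H →L[ℂ] H) (u : H) (hu : ‖u‖ = 1)
    (hQ : ∀ x, Q x = ⟪u, x⟫_ℂ • u) :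
    ∑' i, ⟪e i, (Q * B * Q) (e i)⟫_ℂ = ⟪u, B u⟫_ℂ := by
  rw [pt_sandwich Q B u hQ]
  have h := e.tsum_inner_mul_inner u u
  rw [inner_self_eq_norm_sq_to_K, hu] at h
  simp only [smul_apply, hQ, inner_smul_right]
  rw [tsum_mul_left, h]; simp

lemma pt_mem (Q B : H →L[ℂ] H) (u : H) (hu : ‖u‖ = 1)
    (hQ : ∀ x, Q x = ⟪u, x⟫_ℂ • u) : ⟪u, B u⟫_ℂ ∈ spectrum ℂ (Q * B * Q) := by
  apply pt_eig _ _ u (by rintro rfl; simp at hu)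
  rw [pt_sandwich Q B u hQ]
  simp [hQ, hu, inner_self_eq_norm_sq_to_K]

lemma pt_sub [Nontrivial H] (Q B : H →L[ℂ] H) (u : H) (hu : ‖u‖ = 1)
    (hQ : ∀ x, Q x = ⟪u, x⟫_ℂ • u) {z : ℂ} (hz : z ∈ spectrum ℂ (Q * B * Q)) :
    z = 0 ∨ z = ⟪u, B u⟫_ℂ := by
  refine pt_spec_quad _ _ ?_ hz
  rw [pt_sandwich Q B u hQ]
  ext x
  simp [hQ, hu, inner_self_eq_norm_sq_to_K, inner_smul_right]

lemma pt_unit (Q : H →L[ℂ] H) (v : H) (hv : v ≠ 0) (hQv : Q v = v) :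
    ‖((‖v‖ : ℂ)⁻¹ • v)‖ = 1 ∧ Q ((‖v‖ : ℂ)⁻¹ • v) = (‖v‖ : ℂ)⁻¹ • v := by
  constructor
  · rw [norm_smul]; simp [hv]
  · rw [map_smul, hQv]

lemma pt_inner (Q : H →L[ℂ] H) (hQ : IsSelfAdjoint Q) (u x : H) (hu : Q u = u) :
    ⟪u, Q x⟫_ℂ = ⟪u, x⟫_ℂ := by
  have h := (ContinuousLinearMap.isSelfAdjoint_iff_isSymmetric.1 hQ) u x
  simp only [ContinuousLinearMap.coe_coe, hu] at h
  exact h.symm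

lemma pt_rank (P : H →L[ℂ] H) (hP : IsRankOneProjection P) :
    ∃ u : H, ‖u‖ = 1 ∧ ∀ x, P x = ⟪u, x⟫_ℂ • u := by
  obtain ⟨hsa, hid, hr⟩ := hP
  unfold IsRankOne at hr
  obtain ⟨⟨v, w, hw⟩, hv0, hv⟩ := finrank_eq_one_iff'.1 hr
  have hw' : P w = v := hw
  have hv0' : v ≠ 0 := fun h => hv0 (Subtype.ext h)
  have hPv : P v = v := by
    rw [← hw', ← mul_apply_eq_comp, hid]
  obtain ⟨h1, h2⟩ := pt_unit P v hv0' hPv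
  refine ⟨_, h1, fun x => ?_⟩
  obtain ⟨c, hc⟩ := hv ⟨P x, x, rfl⟩
  have hc' : c • v = P x := congrArg Subtype.val hc
  set u := (‖v‖ : ℂ)⁻¹ • v with hu
  have hvu : v = (‖v‖ : ℂ) • u := by
    rw [hu, smul_smul, mul_inv_cancel₀ (by simpa using hv0'), one_smul]
  have hPx : P x = (c * ‖v‖) • u := by
    rw [← hc', ← smul_smul, ← hvu]
  have h3 := pt_inner P hsa u x h2
  rw [hPx, inner_smul_right, inner_self_eq_norm_sq_to_K, h1] at h3
  rw [hPx, ← h3]; simp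

end helpers

theorem preserver_trace (ι : Type*)
    {H : Type*} [NormedAddCommGroup H] [InnerProductSpace ℂ H] [CompleteSpace H]
    (hH : ¬ FiniteDimensional ℂ H)
    (r s : ℚ) (hr : 0 < r) (hs : 0 < s) (hrs : 1 < r + s)
    (φ : selfAdjoint (H →L[ℂ] H) → selfAdjoint (H →L[ℂ] H))
    (hφ : Function.Surjective φ)
    (hspec : ∀ A : selfAdjoint (H →L[ℂ] H),
      (IsRankOneProjection (A : H →L[ℂ] H) ∨ (A : H →L[ℂ] H) = 1) →
      ∀ B : selfAdjoint (H →L[ℂ] H),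
        spectrum ℂ (absPow (A : H →L[ℂ] H) r * (B : H →L[ℂ] H) * absPow (A : H →L[ℂ] H) s) =
        spectrum ℂ (absPow (φ A : H →L[ℂ] H) r * (φ B : H →L[ℂ] H) *
          absPow (φ A : H →L[ℂ] H) s)):
    ∀ P B : selfAdjoint (H →L[ℂ] H), IsRankOneProjection (P : H →L[ℂ] H) →
      ∀ e : HilbertBasis ι ℂ H,
        ∑' i, ⟪ e i, ((P : H →L[ℂ] H) * (B : H →L[ℂ] H) * (P : H →L[ℂ] H)) (e i)⟫_ℂ =
        ∑' i, ⟪ e i, ((φ P : H →L[ℂ] H) * (φ B : H →L[ℂ] H) * (φ P : H →L[ℂ] H)) (e i)⟫_ℂ := by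
  have hnt : Nontrivial H := by
    by_contra hn
    rw [not_nontrivial_iff_subsingleton] at hn
    exact hH inferInstance
  have hr' : (0 : ℝ) < (r : ℝ) := by exact_mod_cast hr
  have hs' : (0 : ℝ) < (s : ℝ) := by exact_mod_cast hs
  have hone : (φ 1 : H →L[ℂ] H) = 1 := by
    apply pt_one _ (φ 1).2 r s hr' hs'
    intro z hz
    rw [← hspec 1 (Or.inr rfl) 1, selfAdjoint.val_one,
      pt_absPow 1 (.one _) (one_mul 1) r hr',
      pt_absPow 1 (.one _) (one_mul 1) s hs', one_mul, one_mul, spectrum.one_eq] at hz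
    exact hz
  have hσ : ∀ B : selfAdjoint (H →L[ℂ] H), spectrum ℂ (B : H →L[ℂ] H) = spectrum ℂ (φ B : H →L[ℂ] H) := by
    intro B
    have h := hspec 1 (Or.inr rfl) B
    rw [hone, selfAdjoint.val_one, pt_absPow 1 (.one _) (one_mul 1) r hr',
      pt_absPow 1 (.one _) (one_mul 1) s hs', one_mul, one_mul, mul_one, mul_one] at h
    exact h
  intro P B hP e
  obtain ⟨u, hu, hPu⟩ := pt_rank (P : H →L[ℂ] H) hP
  have hQQ : (φ P : H →L[ℂ] H) * (φ P : H →L[ℂ] H) = φ P := by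
    apply pt_idem _ (φ P).2
    intro z hz
    rw [← hσ P] at hz
    exact pt_spec_quad _ 1 (by simpa using hP.2.1) hz
  have hσP : ∀ B : selfAdjoint (H →L[ℂ] H),
      spectrum ℂ ((P : H →L[ℂ] H) * (B : H →L[ℂ] H) * (P : H →L[ℂ] H)) =
      spectrum ℂ ((φ P : H →L[ℂ] H) * (φ B : H →L[ℂ] H) * (φ P : H →L[ℂ] H)) := by
    intro B
    have h := hspec P (Or.inl hP) B
    rwa [pt_absPow _ hP.1 hP.2.1 r hr', pt_absPow _ hP.1 hP.2.1 s hs',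
      pt_absPow _ (φ P).2 hQQ r hr', pt_absPow _ (φ P).2 hQQ s hs'] at h
  have hQ0 : (φ P : H →L[ℂ] H) ≠ 0 := by
    intro h0
    have h1 : (1 : ℂ) ∈ spectrum ℂ (P : H →L[ℂ] H) := by
      apply pt_eig _ _ u (by rintro rfl; simp at hu)
      rw [hPu, inner_self_eq_norm_sq_to_K, hu]; simp
    rw [hσ, h0, spectrum.zero_eq] at h1
    simp at h1
  have hQsa : IsSelfAdjoint (φ P : H →L[ℂ] H) := (φ P).2
  have hrep : ∃ v : H, ‖v‖ = 1 ∧ ∀ x, (φ P : H →L[ℂ] H) x = ⟪v, x⟫_ℂ • v := by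
    generalize (φ P : H →L[ℂ] H) = Q at *
    obtain ⟨w, hw⟩ : ∃ w, Q w ≠ 0 := by
      by_contra! hn
      exact hQ0 (ContinuousLinearMap.ext hn)
    obtain ⟨h1, h2⟩ := pt_unit Q (Q w) hw (by rw [← mul_apply_eq_comp, hQQ])
    refine ⟨_, h1, ?_⟩
    generalize ((‖Q w‖ : ℂ)⁻¹ • Q w) = v at h1 h2
    by_contra! hn
    obtain ⟨x, hx⟩ := hn
    have hy0 : Q x - ⟪v, x⟫_ℂ • v ≠ 0 := sub_ne_zero.2 hx
    have hQy : Q (Q x - ⟪v, x⟫_ℂ • v) = Q x - ⟪v, x⟫_ℂ • v := by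
      rw [map_sub, map_smul, h2, ← mul_apply_eq_comp, hQQ]
    have hvy : ⟪v, Q x - ⟪v, x⟫_ℂ • v⟫_ℂ = 0 := by
      rw [inner_sub_right, pt_inner Q hQsa v x h2, inner_smul_right,
        inner_self_eq_norm_sq_to_K, h1]
      simp
    obtain ⟨h3, h4⟩ := pt_unit Q _ hy0 hQy
    have h5 : ⟪v, (‖Q x - ⟪v, x⟫_ℂ • v‖ : ℂ)⁻¹ • (Q x - ⟪v, x⟫_ℂ • v)⟫_ℂ = 0 := by
      rw [inner_smul_right, hvy, mul_zero]
    generalize (‖Q x - ⟪v, x⟫_ℂ • v‖ : ℂ)⁻¹ • (Q x - ⟪v, x⟫_ℂ • v) = y at h3 h4 h5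
    have h6 : ⟪y, v⟫_ℂ = 0 := inner_eq_zero_symm.1 h5
    have hCsa : IsSelfAdjoint (InnerProductSpace.rankOne ℂ v v +
        (2 : ℝ) • InnerProductSpace.rankOne ℂ y y : H →L[ℂ] H) :=
      (ContinuousLinearMap.isSelfAdjoint_iff_isSymmetric.2 (InnerProductSpace.isSymmetric_rankOne_self v)).add
        ((IsSelfAdjoint.all (2 : ℝ)).smul (ContinuousLinearMap.isSelfAdjoint_iff_isSymmetric.2 (InnerProductSpace.isSymmetric_rankOne_self y)))
    obtain ⟨C, hC⟩ := hφ ⟨_, hCsa⟩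
    have hs := hσP C
    rw [hC] at hs
    have e1 : (1 : ℂ) ∈ spectrum ℂ ((P : H →L[ℂ] H) * (C : H →L[ℂ] H) * (P : H →L[ℂ] H)) := by
      rw [hs]
      apply pt_eig _ _ v (by rintro rfl; simp at h1)
      simp [h2, h6, inner_self_eq_norm_sq_to_K, h1]
    have e2 : (2 : ℂ) ∈ spectrum ℂ ((P : H →L[ℂ] H) * (C : H →L[ℂ] H) * (P : H →L[ℂ] H)) := by
      rw [hs]
      apply pt_eig _ _ y (by rintro rfl; simp at h3)
      have : ((2 : ℝ) • y) = (2 : ℂ) • y := by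
        rw [two_smul, two_smul]
      simp [h4, h5, inner_self_eq_norm_sq_to_K, h3, this]
    have f1 := pt_sub _ _ u hu hPu e1
    have f2 := pt_sub _ _ u hu hPu e2
    rcases f1 with f1 | f1
    · norm_num at f1
    · rcases f2 with f2 | f2
      · norm_num at f2
      · rw [← f1] at f2; norm_num at f2
  obtain ⟨v, hv, hQv⟩ := hrep
  rw [pt_trace e _ _ u hu hPu, pt_trace e _ _ v hv hQv]
  have m1 := pt_mem _ (B : H →L[ℂ] H) u hu hPu
  have m2 := pt_mem _ (φ B : H →L[ℂ] H) v hv hQv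
  rw [hσP] at m1
  rw [← hσP] at m2
  rcases pt_sub _ _ v hv hQv m1 with h | h
  · rcases pt_sub _ _ u hu hPu m2 with h' | h'
    · rw [h, h']
    · exact h'.symm
  · exact h
end

section
/- Let H be an infinite-dimensional complex Hilbert space, let r be a positive rational number with r > 1, and let φ : B(H) → B(H) be a surjective map satisfying σ(|A|^r B) = σ(|φ(A)|^r φ(B)) for all A, B ∈ B(H). Then φ is injective. -/
open scoped InnerProductSpace

theorem absPow_proj_aux {H : Type*} [NormedAddCommGroup H] [InnerProductSpace ℂ H]
    [CompleteSpace H] (P : H →L[ℂ] H) (hP : IsStarProjection P) (r : ℝ) (hr : r ≠ 0) :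
    absPow P r = P := by
  have hsa : IsSelfAdjoint P := hP.isSelfAdjoint
  have hid : IsIdempotentElem P := hP.isIdempotentElem
  have key : ∀ f : ℝ → ℝ, f 0 = 0 → f 1 = 1 → cfc f P = P := by
    intro f h0 h1
    have : cfc f P = cfc (id : ℝ → ℝ) P := by
      apply cfc_congr
      intro t ht
      rcases hid.spectrum_subset ℝ ht with h | h
      · subst h; simpa using h0
      · have : t = 1 := h
        subst this; simpa using h1
    rw [this, cfc_id ℝ P]
  have h1 : absOp P = P := by
    unfold absOp
    rw [hsa.star_eq, hid.eq]
    exact key _ (by simp) (by simp)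
  unfold absPow
  rw [h1]
  exact key _ (by simp [Real.zero_rpow hr]) (by simp)

theorem mem_spec_aux {H : Type*} [NormedAddCommGroup H] [InnerProductSpace ℂ H]
    [CompleteSpace H] (x : H) (hx : ‖x‖ = 1) (A : H →L[ℂ] H) :
    inner ℂ x (A x) ∈ spectrum ℂ (InnerProductSpace.rankOne ℂ x x * A) := by
  intro h
  obtain ⟨u, hu⟩ := h
  have h0 : (u : H →L[ℂ] H) x = 0 := by
    rw [hu]
    simp [Algebra.algebraMap_eq_smul_one]
  have h1 : ((↑u⁻¹ : H →L[ℂ] H) * (u : H →L[ℂ] H)) x = 0 := by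
    rw [ContinuousLinearMap.mul_apply, h0, map_zero]
  rw [Units.inv_mul] at h1
  have : x = 0 := h1
  simp [this] at hx

theorem spec_mem_aux {H : Type*} [NormedAddCommGroup H] [InnerProductSpace ℂ H]
    [CompleteSpace H] (x : H) (hx : ‖x‖ = 1) (A : H →L[ℂ] H) (k : ℂ) (hk : k ≠ 0)
    (h : k ∈ spectrum ℂ (InnerProductSpace.rankOne ℂ x x * A)) :
    k = inner ℂ x (A x) := by
  have hid := InnerProductSpace.isIdempotentElem_rankOne_self (𝕜 := ℂ) hx
  have hnt : Nontrivial H := ⟨x, 0, by rintro rfl; simp at hx⟩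
  set P := InnerProductSpace.rankOne ℂ x x with hPdef
  have h2 : k ∈ spectrum ℂ (P * A * P) \ {0} := by
    rw [spectrum.nonzero_mul_comm, ← mul_assoc, hid.eq]
    exact ⟨h, hk⟩
  have h3 : P * A * P = (inner ℂ x (A x) : ℂ) • P := by
    ext y
    simp [hPdef, smul_smul, mul_comm]
  rw [h3, spectrum.smul_eq_smul _ _ (spectrum.nonempty P)] at h2
  obtain ⟨⟨t, ht, hkt⟩, -⟩ := h2
  simp only [smul_eq_mul] at hkt
  rcases hid.spectrum_subset ℂ ht with h | h
  · subst h; simp at hkt; exact absurd hkt.symm hk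
  · have : t = 1 := h
    subst this; simpa using hkt.symm

theorem bounded_preserver_injective
    {H : Type*} [NormedAddCommGroup H] [InnerProductSpace ℂ H] [CompleteSpace H]
    (hH : ¬ FiniteDimensional ℂ H)
    (r : ℚ) (hr : 1 < r)
    (φ : (H →L[ℂ] H) → (H →L[ℂ] H))
    (hφ : Function.Surjective φ)
    (hspec : ∀ A B : H →L[ℂ] H,
      spectrum ℂ (absPow A r * B) = spectrum ℂ (absPow (φ A) r * φ B)):
    Function.Injective φ := by
  have hr0 : (r : ℝ) ≠ 0 := by
    have : (r : ℚ) ≠ 0 := by linarith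
    exact_mod_cast this
  intro A B hAB
  have hs : ∀ C, spectrum ℂ (absPow C r * A) = spectrum ℂ (absPow C r * B) := by
    intro C
    rw [hspec C A, hspec C B, hAB]
  have hunit : ∀ x : H, ‖x‖ = 1 → inner ℂ x (A x) = inner ℂ x (B x) := by
    intro x hx
    have h := hs (InnerProductSpace.rankOne ℂ x x)
    rw [absPow_proj_aux _ (InnerProductSpace.isStarProjection_rankOne_self hx) _ hr0] at h
    have hA := mem_spec_aux x hx A
    have hB := mem_spec_aux x hx B
    rw [h] at hA
    rw [← h] at hB
    by_cases ha : inner ℂ x (A x) = 0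
    · by_cases hb : inner ℂ x (B x) = 0
      · rw [ha, hb]
      · exact (spec_mem_aux x hx A _ hb hB).symm
    · exact spec_mem_aux x hx B _ ha hA
  have hall : ∀ x : H, inner ℂ x (A x) = inner ℂ x (B x) := by
    intro x
    by_cases hx : x = 0
    · simp [hx]
    have hn : (‖x‖ : ℂ) ≠ 0 := by simpa using hx
    have h := hunit ((‖x‖ : ℂ)⁻¹ • x) (by
      rw [norm_smul, norm_inv, Complex.norm_real, norm_norm]
      exact inv_mul_cancel₀ (norm_ne_zero_iff.mpr hx))
    simpa [inner_smul_left, inner_smul_right, hn, hx] using h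
  have := (ext_inner_map (A : H →ₗ[ℂ] H) (B : H →ₗ[ℂ] H)).1 (by
    intro x
    have h := congrArg (starRingEnd ℂ) (hall x)
    simpa using h)
  exact ContinuousLinearMap.coe_injective this
end

section
/- Let H be an infinite-dimensional complex Hilbert space, let r be a positive rational number with r > 1, and let φ : B(H) → B(H) be a surjective map satisfying σ(|A|^r B) = σ(|φ(A)|^r φ(B)) for all A, B ∈ B(H). Then for every A ∈ B(H), |A|^r = 0 if and only if |φ(A)|^r = 0. -/
open scoped InnerProductSpace

theorem aux_zero_of_spectrum {H : Type*} [NormedAddCommGroup H] [InnerProductSpace ℂ H]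
    [CompleteSpace H] (P : H →L[ℂ] H)
    (h : spectrum ℂ (P * star P) = spectrum ℂ (0 : H →L[ℂ] H)) : P = 0 := by
  have h1 : spectralRadius ℂ (P * star P) = ‖P * star P‖₊ :=
    (IsSelfAdjoint.mul_star_self P).spectralRadius_eq_nnnorm
  have h2 : spectralRadius ℂ (P * star P) = spectralRadius ℂ (0 : H →L[ℂ] H) := by
    unfold spectralRadius
    rw [h]
  rw [h2, spectrum.spectralRadius_zero] at h1
  have h3 : ‖P * star P‖₊ = 0 := by exact_mod_cast h1.symm
  exact (CStarRing.mul_star_self_eq_zero_iff P).1 (nnnorm_eq_zero.1 h3)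

theorem bounded_preserver_absPow_zero
    {H : Type*} [NormedAddCommGroup H] [InnerProductSpace ℂ H] [CompleteSpace H]
    (hH : ¬ FiniteDimensional ℂ H)
    (r : ℚ) (hr : 1 < r)
    (φ : (H →L[ℂ] H) → (H →L[ℂ] H))
    (hφ : Function.Surjective φ)
    (hspec : ∀ A B : H →L[ℂ] H,
      spectrum ℂ (absPow A r * B) = spectrum ℂ (absPow (φ A) r * φ B)):
    ∀ A : H →L[ℂ] H, absPow A r = 0 ↔ absPow (φ A) r = 0 := by
  intro A
  constructor
  · intro hA
    obtain ⟨B, hB⟩ := hφ (star (absPow (φ A) r))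
    apply aux_zero_of_spectrum
    rw [← hB, ← hspec A B, hA, zero_mul]
  · intro hA
    apply aux_zero_of_spectrum
    rw [hspec, hA, zero_mul]
end

section
/- Let H be an infinite-dimensional complex Hilbert space, let r be a positive rational number with r > 1, and let φ : B(H) → B(H) be a surjective map satisfying σ(|A|^r B) = σ(|φ(A)|^r φ(B)) for all A, B ∈ B(H). Then for every B ∈ B(H), B is self-adjoint if and only if φ(B) is self-adjoint. -/
open scoped InnerProductSpace

section aux
variable {H : Type*} [NormedAddCommGroup H] [InnerProductSpace ℂ H] [CompleteSpace H]

lemma aux_cfc_proj (P : H →L[ℂ] H) (hs : IsSelfAdjoint P) (hi : P * P = P) (f : ℝ → ℝ)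
    (h0 : f 0 = 0) (h1 : f 1 = 1) : cfc f P = P := by
  have hsp : ∀ t ∈ spectrum ℝ P, t = 0 ∨ t = 1 := by
    intro t ht
    have hi' : IsIdempotentElem P := hi
    have := hi'.spectrum_subset ℝ ht
    simpa using this
  have : cfc f P = cfc (id : ℝ → ℝ) P := by
    apply cfc_congr
    intro t ht
    rcases hsp t ht with h | h <;> simp [h, h0, h1]
  rw [this, cfc_id ℝ P]

lemma aux_absPow_proj (P : H →L[ℂ] H) (hs : IsSelfAdjoint P) (hi : P * P = P) (r : ℝ)
    (hr : r ≠ 0) : absPow P r = P := by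
  have h1 : absOp P = P := by
    unfold absOp
    rw [hs.star_eq, hi]
    exact aux_cfc_proj P hs hi _ (by simp) (by simp)
  unfold absPow
  rw [h1]
  exact aux_cfc_proj P hs hi _ (Real.zero_rpow hr) (by simp)

lemma aux_absPow_nonneg (A : H →L[ℂ] H) (r : ℝ) : 0 ≤ absPow A r := by
  unfold absPow
  apply cfc_nonneg
  intro t ht
  apply Real.rpow_nonneg
  have : 0 ≤ absOp A := cfc_nonneg (fun t _ => Real.sqrt_nonneg t)
  exact spectrum_nonneg_of_nonneg this ht

lemma aux_iff (B : H →L[ℂ] H) (r : ℝ) (hr : r ≠ 0) :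
    IsSelfAdjoint B ↔ ∀ A : H →L[ℂ] H, ∀ z ∈ spectrum ℂ (absPow A r * B), z.im = 0 := by
  constructor
  · intro hB A z hz
    by_cases hz0 : z = 0
    · simp [hz0]
    obtain ⟨S, hS, hSS⟩ : ∃ S : H →L[ℂ] H, IsSelfAdjoint S ∧ S * S = absPow A r :=
      ⟨CFC.sqrt (absPow A r), IsSelfAdjoint.of_nonneg (CFC.sqrt_nonneg _),
        CFC.sqrt_mul_sqrt_self _ (aux_absPow_nonneg A r)⟩
    rw [← hSS, mul_assoc] at hz
    have h2 : z ∈ spectrum ℂ (S * (S * B)) \ {0} := ⟨hz, hz0⟩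
    rw [spectrum.nonzero_mul_comm] at h2
    have h3 : IsSelfAdjoint (S * B * S) := by
      have := hB.conjugate S
      rwa [hS.star_eq] at this
    exact h3.im_eq_zero_of_mem_spectrum h2.1
  · intro h
    rw [ContinuousLinearMap.isSelfAdjoint_iff_isSymmetric]
    rw [LinearMap.isSymmetric_iff_inner_map_self_real]
    have key : ∀ x : H, (⟪x, B x⟫_ℂ).im = 0 := by
      intro x
      by_cases hx : x = 0
      · simp [hx]
      set P : H →L[ℂ] H := (ℂ ∙ x).starProjection with hP
      have hsp : IsStarProjection P := isStarProjection_starProjection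
      have h1 := h P
      rw [aux_absPow_proj P hsp.isSelfAdjoint hsp.isIdempotentElem r hr] at h1
      have h2 := h1 (⟪x, B x⟫_ℂ / ((‖x‖ : ℂ) ^ 2)) (by
        rw [spectrum.mem_iff]
        intro hu
        obtain ⟨u, hu⟩ := hu
        apply hx
        have e : (u : H →L[ℂ] H) x = 0 := by
          rw [hu]
          simp [hP, Submodule.starProjection_singleton, Algebra.algebraMap_eq_smul_one]
        have : (↑u⁻¹ * (u : H →L[ℂ] H)) x = 0 := by
          rw [mul_apply_eq_comp, e, map_zero]
        simpa using this)
      have hn : (‖x‖ ^ 2 : ℝ) ≠ 0 := by simpa using hx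
      rw [← Complex.ofReal_pow, Complex.div_ofReal_im] at h2
      exact (div_eq_zero_iff.mp h2).resolve_right hn
    intro x
    have e : (⟪B x, x⟫_ℂ).im = 0 := by
      rw [← inner_conj_symm, Complex.conj_im, key x, neg_zero]
    exact Complex.conj_eq_iff_im.mpr e
end aux

theorem bounded_preserver_selfAdjoint
    {H : Type*} [NormedAddCommGroup H] [InnerProductSpace ℂ H] [CompleteSpace H]
    (hH : ¬ FiniteDimensional ℂ H)
    (r : ℚ) (hr : 1 < r)
    (φ : (H →L[ℂ] H) → (H →L[ℂ] H))
    (hφ : Function.Surjective φ)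
    (hspec : ∀ A B : H →L[ℂ] H,
      spectrum ℂ (absPow A r * B) = spectrum ℂ (absPow (φ A) r * φ B)):
    ∀ B : H →L[ℂ] H, IsSelfAdjoint B ↔ IsSelfAdjoint (φ B) := by
  intro B
  have hr0 : (r : ℝ) ≠ 0 := by
    have : r ≠ 0 := by linarith
    exact_mod_cast this
  rw [aux_iff B r hr0, aux_iff (φ B) r hr0]
  constructor
  · intro h A
    obtain ⟨C, rfl⟩ := hφ A
    rw [← hspec C B]
    exact h C
  · intro h A
    rw [hspec A B]
    exact h (φ A)
end
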